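/- (Pieri formula for Schur polynomials) Let r ≥ 1, let λ be a partition with at most r parts, and let b ≥ 0. Then in ℤ[x_1, …, x_r]: s_λ(x_1, …, x_r) · h_b(x_1, …, x_r) = Σ_μ s_μ(x_1, …, x_r), the sum over all partitions μ with at most r parts satisfying μ_1 ≥ λ_1 ≥ μ_2 ≥ λ_2 ≥ ⋯ ≥ μ_r ≥ λ_r and |μ| = |λ| + b. -/

import Mathlib

open MvPolynomial

/-- The complete homogeneous symmetric polynomial `h_b(x₁, …, x_r)` of degree `b` in
`ℤ[x₁, …, x_r] = MvPolynomial (Fin r) ℤ`. -/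
noncomputable def completeHomog (r b : ℕ) : MvPolynomial (Fin r) ℤ :=
  ∑ s ∈ Finset.sym (Finset.univ : Finset (Fin r)) b, ((s : Multiset (Fin r)).map X).prod

/-- `h_b(x₁, …, x_r)` for an integer degree `b`, with `h_b = 0` for `b < 0`. -/
noncomputable def completeHomogZ (r : ℕ) (b : ℤ) : MvPolynomial (Fin r) ℤ :=
  if b < 0 then 0 else completeHomog r b.toNat

/-- The Schur polynomial `s_λ(x₁, …, x_r)` of a partition `λ = (λ₁ ≥ ⋯ ≥ λ_r ≥ 0)` with at
most `r` parts, defined by the Jacobi–Trudi determinant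
`s_λ = det [ h_{λ_i + j - i} ]_{i,j = 1,…,r}`. -/
noncomputable def schurPoly {r : ℕ} (l : Fin r → ℕ) : MvPolynomial (Fin r) ℤ :=
  Matrix.det (Matrix.of fun i j : Fin r =>
    completeHomogZ r (((l i : ℕ) : ℤ) + (j : ℕ) - (i : ℕ)))

/-- complete homogeneous polynomial in a subset of the variables -/
noncomputable def hS (r : ℕ) (T : Finset (Fin r)) (b : ℕ) : MvPolynomial (Fin r) ℤ :=
  ∑ s ∈ Finset.sym T b, ((s : Multiset (Fin r)).map X).prod

noncomputable def hSZ (r : ℕ) (T : Finset (Fin r)) (b : ℤ) : MvPolynomial (Fin r) ℤ :=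
  if b < 0 then 0 else hS r T b.toNat

lemma hS_succ (r : ℕ) (T : Finset (Fin r)) (a : Fin r) (ha : a ∉ T) (n : ℕ) :
    hS r (insert a T) (n + 1) = hS r T (n + 1) + X a * hS r (insert a T) n := by
  classical
  unfold hS
  rw [← Finset.sum_filter_add_sum_filter_not _ (fun s : Sym (Fin r) (n+1) => a ∉ s)]
  congr 1
  · apply Finset.sum_congr _ (fun _ _ => rfl)
    ext s
    simp only [Finset.mem_filter, Finset.mem_sym_iff, Finset.mem_insert]
    constructor
    · rintro ⟨h1, h2⟩ c hc
      rcases h1 c hc with rfl | h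
      · exact absurd hc h2
      · exact h
    · intro h
      exact ⟨fun c hc => Or.inr (h c hc), fun hc => ha (h a hc)⟩
  · rw [Finset.mul_sum]
    symm
    apply Finset.sum_bij (fun (s : Sym (Fin r) n) _ => a ::ₛ s)
    · intro s hs
      simp only [Finset.mem_filter, Finset.mem_sym_iff, Finset.mem_insert, Sym.mem_cons] at hs ⊢
      refine ⟨?_, by simp⟩
      rintro c (h | h)
      · exact Or.inl h
      · exact hs c h
    · intro s _ t _ h
      exact (Sym.cons_inj_right a s t).1 h
    · intro s hs
      simp only [Finset.mem_filter, Finset.mem_sym_iff, not_not] at hs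
      obtain ⟨t, rfl⟩ := Sym.exists_cons_of_mem hs.2
      refine ⟨t, ?_, rfl⟩
      rw [Finset.mem_sym_iff]
      intro c hc
      exact hs.1 c (Sym.mem_cons_of_mem hc)
    · intro s _
      rw [Sym.coe_cons, Multiset.map_cons, Multiset.prod_cons]

lemma hS_zero (r : ℕ) (T : Finset (Fin r)) : hS r T 0 = 1 := by
  simp only [hS, Finset.sym_zero, Finset.sum_singleton]
  exact Multiset.prod_zero

lemma hSZ_rec (r : ℕ) (T : Finset (Fin r)) (a : Fin r) (ha : a ∉ T) (n : ℤ) :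
    hSZ r T n = hSZ r (insert a T) n - X a * hSZ r (insert a T) (n - 1) := by
  unfold hSZ
  rcases lt_trichotomy n 0 with h | rfl | h
  · rw [if_pos h, if_pos h, if_pos (by omega)]; simp
  · simp [hS_zero]
  · obtain ⟨k, rfl⟩ : ∃ k : ℕ, n = k + 1 := ⟨(n - 1).toNat, by omega⟩
    rw [if_neg (by omega), if_neg (by omega), if_neg (by omega)]
    have h1 : ((k : ℤ) + 1).toNat = k + 1 := by omega
    have h2 : ((k : ℤ) + 1 - 1).toNat = k := by omega
    rw [h1, h2, hS_succ r T a ha]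
    ring

lemma hSZ_comb (r : ℕ) (T U : Finset (Fin r)) (hTU : Disjoint T U) :
    ∃ c : ℕ → MvPolynomial (Fin r) ℤ, ∀ n : ℤ,
      hSZ r T n = ∑ k ∈ Finset.range (U.card + 1), c k * hSZ r (T ∪ U) (n - k) := by
  classical
  induction U using Finset.induction_on generalizing T with
  | empty => exact ⟨fun _ => 1, fun n => by simp⟩
  | insert a U haU ih =>
    rw [Finset.disjoint_insert_right] at hTU
    obtain ⟨c, hc⟩ := ih (insert a T) (by
      rw [Finset.disjoint_insert_left]; exact ⟨haU, hTU.2⟩)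
    have hu : insert a T ∪ U = T ∪ insert a U := by
      ext x; simp only [Finset.mem_union, Finset.mem_insert]; tauto
    rw [hu] at hc
    refine ⟨fun k => (if k < U.card + 1 then c k else 0)
      - (if k = 0 then 0 else X a * c (k - 1)), fun n => ?_⟩
    rw [hSZ_rec r T a hTU.1, hc n, hc (n - 1), Finset.card_insert_of_notMem haU]
    simp only [sub_mul, Finset.sum_sub_distrib]
    congr 1
    · rw [Finset.sum_range_succ _ (U.card + 1)]
      simp only [lt_irrefl, if_false, zero_mul, add_zero]
      apply Finset.sum_congr rfl
      intro k hk
      rw [if_pos (Finset.mem_range.1 hk)]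
    · rw [Finset.sum_range_succ' _ (U.card + 1), Finset.mul_sum]
      simp only [if_true, zero_mul, add_zero]
      apply Finset.sum_congr rfl
      intro k hk
      rw [if_neg (by omega), Nat.add_sub_cancel]
      have : n - 1 - (k : ℤ) = n - ((k + 1 : ℕ) : ℤ) := by push_cast; ring
      rw [this]
      ring

lemma pow_comb (r : ℕ) (j : Fin r) :
    ∃ c : ℕ → MvPolynomial (Fin r) ℤ, ∀ n : ℕ,
      (X j : MvPolynomial (Fin r) ℤ) ^ n
        = ∑ k ∈ Finset.range r, c k * completeHomogZ r ((n : ℤ) - k) := by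
  classical
  obtain ⟨c, hc⟩ := hSZ_comb r {j} (Finset.univ.erase j) (by simp)
  refine ⟨c, fun n => ?_⟩
  have h := hc n
  have hu : {j} ∪ Finset.univ.erase j = (Finset.univ : Finset (Fin r)) := by
    ext x; simp
  have hr : 0 < r := j.pos
  rw [hu, Finset.card_erase_of_mem (Finset.mem_univ _), Finset.card_univ, Fintype.card_fin,
    Nat.sub_add_cancel hr] at h
  rw [show (X j : MvPolynomial (Fin r) ℤ) ^ n = hSZ r {j} n by
    rw [hSZ, if_neg (by omega), hS, Int.toNat_natCast, Finset.sym_singleton,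
      Finset.sum_singleton, Sym.coe_replicate, Multiset.map_replicate, Multiset.prod_replicate], h]
  rfl

/-- alternant -/
noncomputable def alt {r : ℕ} (g : Fin r → ℕ) : MvPolynomial (Fin r) ℤ :=
  Matrix.det (Matrix.of fun i j : Fin r => (X j : MvPolynomial (Fin r) ℤ) ^ g i)

lemma alt_eq (r : ℕ) : ∃ d : MvPolynomial (Fin r) ℤ, d ≠ 0 ∧
    ∀ m : Fin r → ℕ, schurPoly m * d = alt (fun i => m i + (r - 1 - (i : ℕ))) := by
  choose c hc using pow_comb r
  let M : Matrix (Fin r) (Fin r) (MvPolynomial (Fin r) ℤ) :=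
    Matrix.of fun k j => c j (Fin.rev k : Fin r)
  have key : ∀ g : Fin r → ℕ, alt g = Matrix.det (Matrix.of fun i k : Fin r =>
      completeHomogZ r ((g i : ℤ) - ((Fin.rev k : Fin r) : ℕ))) * M.det := by
    intro g
    rw [← Matrix.det_mul, alt]
    congr 1
    ext1 i j
    rw [Matrix.mul_apply]
    simp only [Matrix.of_apply, M]
    rw [hc j (g i), Finset.sum_range, ← Equiv.sum_comp Fin.revPerm]
    apply Finset.sum_congr rfl
    intro k _
    simp only [Fin.revPerm_apply]
    ring
  refine ⟨M.det, ?_, fun m => ?_⟩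
  · have h := key (fun i => (i : ℕ))
    intro h0
    rw [h0, mul_zero] at h
    have h2 : Matrix.det (Matrix.vandermonde
        (fun j : Fin r => (X j : MvPolynomial (Fin r) ℤ))) ≠ 0 :=
      Matrix.det_vandermonde_ne_zero_iff.2 (MvPolynomial.X_injective)
    apply h2
    rw [← Matrix.det_transpose, ← h]
    rfl
  · rw [key]
    congr 1
    unfold schurPoly
    congr 1
    ext1 i k
    simp only [Matrix.of_apply]
    congr 1
    rw [Fin.val_rev]
    have := i.2
    have := k.2
    omega

lemma completeHomog_eq (r b : ℕ) : completeHomog r b =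
    ∑ f ∈ Finset.piAntidiag (Finset.univ : Finset (Fin r)) b, ∏ i, X i ^ f i := by
  classical
  rw [← Finset.map_sym_eq_piAntidiag, Finset.sum_map]
  unfold completeHomog
  apply Finset.sum_congr rfl
  intro s _
  rw [Finset.prod_multiset_map_count]
  change _ = ∏ i, X i ^ Multiset.count i (s : Multiset (Fin r))
  apply Finset.prod_subset (Finset.subset_univ _)
  intro x _ hx
  rw [Multiset.count_eq_zero_of_notMem (by simpa using hx), pow_zero]

lemma alt_mul (r b : ℕ) (g : Fin r → ℕ) : alt g * completeHomog r b =
    ∑ f ∈ Finset.piAntidiag (Finset.univ : Finset (Fin r)) b, alt (g + f) := by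
  classical
  have hperm : ∀ σ : Equiv.Perm (Fin r), completeHomog r b =
      ∑ f ∈ Finset.piAntidiag (Finset.univ : Finset (Fin r)) b, ∏ i, X i ^ f (σ i) := by
    intro σ
    rw [completeHomog_eq]
    apply Finset.sum_bij' (fun f _ => f ∘ σ.symm) (fun f _ => f ∘ σ)
    · intro f hf
      simp only [Finset.mem_piAntidiag, Finset.mem_univ, implies_true, and_true] at hf ⊢
      rw [← hf]
      exact Equiv.sum_comp σ.symm f
    · intro f hf
      simp only [Finset.mem_piAntidiag, Finset.mem_univ, implies_true, and_true] at hf ⊢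
      rw [← hf]
      exact Equiv.sum_comp σ f
    · intro f _; ext; simp
    · intro f _; ext; simp
    · intro f _; simp
  simp only [alt, Matrix.det_apply', Matrix.of_apply]
  rw [Finset.sum_comm, Finset.sum_mul]
  apply Finset.sum_congr rfl
  intro σ _
  rw [hperm σ, Finset.mul_sum]
  apply Finset.sum_congr rfl
  intro f _
  simp only [Pi.add_apply, pow_add, Finset.prod_mul_distrib]
  ring

lemma alt_swap {r : ℕ} (g : Fin r → ℕ) (i j : Fin r) (hij : i ≠ j) :
    alt (g ∘ Equiv.swap i j) = - alt g := by
  have := Matrix.det_permute (Equiv.swap i j)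
    (Matrix.of fun i j : Fin r => (X j : MvPolynomial (Fin r) ℤ) ^ g i)
  rw [Equiv.Perm.sign_swap hij] at this
  refine Eq.trans this ?_
  simp [alt]

def Bad {r : ℕ} (l m : Fin r → ℕ) (i : ℕ) : Prop :=
  ∃ h : i + 1 < r, l ⟨i, Nat.lt_of_succ_lt h⟩ < m ⟨i + 1, h⟩

def sw {r : ℕ} (m : Fin r → ℕ) (i : ℕ) : Fin r → ℕ := fun k =>
  if k.val = i then (if h : i + 1 < r then m ⟨i + 1, h⟩ - 1 else m k)
  else if hk : k.val = i + 1 then m ⟨i, Nat.lt_of_succ_lt (lt_of_eq_of_lt hk.symm k.2)⟩ + 1 else m k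

lemma sw_left {r : ℕ} (m : Fin r → ℕ) (i : ℕ) (h : i + 1 < r) :
    sw m i ⟨i, Nat.lt_of_succ_lt h⟩ = m ⟨i + 1, h⟩ - 1 := by simp [sw, h]

lemma sw_right {r : ℕ} (m : Fin r → ℕ) (i : ℕ) (h : i + 1 < r) :
    sw m i ⟨i + 1, h⟩ = m ⟨i, Nat.lt_of_succ_lt h⟩ + 1 := by simp [sw]

lemma sw_other {r : ℕ} (m : Fin r → ℕ) (i : ℕ) (k : Fin r) (h1 : k.val ≠ i)
    (h2 : k.val ≠ i + 1) : sw m i k = m k := by simp [sw, h1, h2]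

lemma sw_delta {r : ℕ} (m : Fin r → ℕ) (i : ℕ) (h : i + 1 < r) (hm : 0 < m ⟨i + 1, h⟩) :
    (fun k : Fin r => sw m i k + (r - 1 - (k : ℕ))) =
      (fun k : Fin r => m k + (r - 1 - (k : ℕ))) ∘
        Equiv.swap (⟨i, Nat.lt_of_succ_lt h⟩ : Fin r) ⟨i + 1, h⟩ := by
  funext k
  simp only [Function.comp]
  by_cases h1 : k.val = i
  · obtain rfl : k = ⟨i, Nat.lt_of_succ_lt h⟩ := Fin.ext h1
    rw [Equiv.swap_apply_left, sw_left m i h]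
    simp only
    omega
  by_cases h2 : k.val = i + 1
  · obtain rfl : k = ⟨i + 1, h⟩ := Fin.ext h2
    rw [Equiv.swap_apply_right, sw_right m i h]
    simp only
    omega
  · rw [Equiv.swap_apply_of_ne_of_ne (fun e => h1 (by rw [e])) (fun e => h2 (by rw [e])),
      sw_other m i k h1 h2]

lemma sw_sw {r : ℕ} (m : Fin r → ℕ) (i : ℕ) (h : i + 1 < r) (hm : 0 < m ⟨i + 1, h⟩) :
    sw (sw m i) i = m := by
  funext k
  by_cases h1 : k.val = i
  · obtain rfl : k = ⟨i, Nat.lt_of_succ_lt h⟩ := Fin.ext h1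
    rw [sw_left _ i h, sw_right m i h]
    simp
  by_cases h2 : k.val = i + 1
  · obtain rfl : k = ⟨i + 1, h⟩ := Fin.ext h2
    rw [sw_right _ i h, sw_left m i h]
    omega
  · rw [sw_other _ i k h1 h2, sw_other m i k h1 h2]

open Classical in
noncomputable def top {r : ℕ} (l m : Fin r → ℕ) : ℕ := Nat.findGreatest (Bad l m) r

lemma top_spec {r : ℕ} (l m : Fin r → ℕ) (hb : ∃ i, Bad l m i) : Bad l m (top l m) := by
  classical
  obtain ⟨i, hi⟩ := hb
  have h := hi.1
  unfold top
  convert Nat.findGreatest_spec (P := Bad l m) (n := r) (by omega) hi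

lemma top_sw {r : ℕ} (l m : Fin r → ℕ) (hb : ∃ i, Bad l m i) (hl : Antitone l)
    (hlm : ∀ i, l i ≤ m i) :
    Bad l (sw m (top l m)) (top l m) ∧ top l (sw m (top l m)) = top l m := by
  classical
  have hs := top_spec l m hb
  have hgt : ∀ k, top l m < k → ¬ Bad l m k := by
    intro k hk hbk
    have h := hbk.1
    exact Nat.findGreatest_is_greatest (P := Bad l m) (n := r) (by
      unfold top at hk; convert hk) (by omega) hbk
  generalize top l m = t at hs hgt ⊢
  obtain ⟨h, hs⟩ := hs
  have hB : Bad l (sw m t) t := by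
    refine ⟨h, ?_⟩
    rw [sw_right m t h]
    have := hlm ⟨t, Nat.lt_of_succ_lt h⟩
    omega
  refine ⟨hB, ?_⟩
  unfold top
  rw [Nat.findGreatest_eq_iff]
  refine ⟨by omega, fun _ => hB, ?_⟩
  rintro k hk _ ⟨hk1, hk2⟩
  apply hgt k hk
  refine ⟨hk1, ?_⟩
  rwa [sw_other _ _ _ (by simp only; omega) (by simp only; omega)] at hk2

lemma bad_sum {r : ℕ} (l : Fin r → ℕ) (hl : Antitone l) (S : Finset (Fin r → ℕ)) (N : ℕ)
    (hS : ∀ m, m ∈ S ↔ ((∀ i, l i ≤ m i) ∧ ∑ i, m i = N) ∧ ∃ i, Bad l m i) :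
    ∑ m ∈ S, alt (fun i => m i + (r - 1 - (i : ℕ))) = 0 := by
  classical
  have hneg : ∀ m ∈ S, alt (fun i => sw m (top l m) i + (r - 1 - (i : ℕ)))
      = - alt (fun i => m i + (r - 1 - (i : ℕ))) := by
    intro m hm
    obtain ⟨h, h'⟩ := top_spec l m ((hS m).1 hm).2
    rw [sw_delta m _ h (by omega), alt_swap]
    intro e
    simp at e
  refine Finset.sum_involution (fun m _ => sw m (top l m)) ?_ ?_ ?_ ?_
  · intro m hm
    rw [hneg m hm, add_neg_cancel]
  · intro m hm h0 he
    have := hneg m hm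
    rw [he] at this
    exact h0 (self_eq_neg.1 this)
  · intro m hm
    obtain ⟨⟨h1, h2⟩, h3⟩ := (hS m).1 hm
    obtain ⟨h, h'⟩ := top_spec l m h3
    have hT := top_sw l m h3 hl h1
    rw [hS]
    refine ⟨⟨?_, ?_⟩, _, hT.1⟩
    · intro k
      by_cases e1 : k.val = top l m
      · obtain rfl : k = ⟨top l m, Nat.lt_of_succ_lt h⟩ := Fin.ext e1
        rw [sw_left m _ h]
        omega
      by_cases e2 : k.val = top l m + 1
      · obtain rfl : k = ⟨top l m + 1, h⟩ := Fin.ext e2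
        rw [sw_right m _ h]
        have a1 := h1 ⟨top l m, Nat.lt_of_succ_lt h⟩
        have a2 : l ⟨top l m + 1, h⟩ ≤ l ⟨top l m, Nat.lt_of_succ_lt h⟩ := hl (by simp [Fin.le_def])
        omega
      · rw [sw_other m _ k e1 e2]; exact h1 k
    · have e := sw_delta m _ h (by omega)
      have e2 := congrArg (fun f : Fin r → ℕ => ∑ i, f i) e
      simp only [Function.comp] at e2
      rw [Equiv.sum_comp (Equiv.swap _ _) (fun k : Fin r => m k + (r - 1 - (k : ℕ))),
        Finset.sum_add_distrib, Finset.sum_add_distrib] at e2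
      omega
  · intro m hm
    obtain ⟨⟨h1, h2⟩, h3⟩ := (hS m).1 hm
    obtain ⟨h, h'⟩ := top_spec l m h3
    have hT := top_sw l m h3 hl h1
    simp only [hT.2]
    exact sw_sw m _ h (by omega)

/-- Pieri formula for Schur polynomials: Let `r ≥ 1`, let `λ` be a partition
with at most `r` parts (an antitone function `Fin r → ℕ`), and let `b ≥ 0`.  Then in
`ℤ[x₁, …, x_r]`: `s_λ · h_b = Σ_μ s_μ`, the sum over all partitions `μ` with at most `r`
parts satisfying the interlacing condition `μ₁ ≥ λ₁ ≥ μ₂ ≥ λ₂ ≥ ⋯ ≥ μ_r ≥ λ_r` and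
`|μ| = |λ| + b`. -/
theorem pieri_schur (r : ℕ) (hr : 1 ≤ r) (l : Fin r → ℕ) (hl : Antitone l) (b : ℕ) :
    schurPoly l * completeHomog r b =
      ∑ᶠ (m : Fin r → ℕ)
        (_ : (∀ i, l i ≤ m i) ∧
             (∀ (i : ℕ) (h : i + 1 < r), m ⟨i + 1, h⟩ ≤ l ⟨i, by omega⟩) ∧
             (∑ i, m i) = (∑ i, l i) + b),
        schurPoly m := by
  classical
  obtain ⟨d, hd, hs⟩ := alt_eq r
  apply mul_right_cancel₀ hd
  let S : Finset (Fin r → ℕ) :=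
    (Finset.piAntidiag (Finset.univ : Finset (Fin r)) b).map (addLeftEmbedding l)
  have hS : ∀ m, m ∈ S ↔ (∀ i, l i ≤ m i) ∧ ∑ i, m i = (∑ i, l i) + b := by
    intro m
    simp only [S, Finset.mem_map, Finset.mem_piAntidiag, Finset.mem_univ, implies_true, and_true,
      addLeftEmbedding_apply]
    constructor
    · rintro ⟨f, hf, rfl⟩
      refine ⟨fun i => by simp, ?_⟩
      simp [Finset.sum_add_distrib, hf]
    · rintro ⟨h1, h2⟩
      have hm : l + (m - l) = m := by
        funext i
        simp only [Pi.add_apply, Pi.sub_apply]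
        have := h1 i
        omega
      refine ⟨m - l, ?_, hm⟩
      rw [← hm] at h2
      simp only [Pi.add_apply, Finset.sum_add_distrib] at h2
      exact Nat.add_left_cancel h2
  have hfin : (∑ᶠ (m : Fin r → ℕ)
        (_ : (∀ i, l i ≤ m i) ∧
             (∀ (i : ℕ) (h : i + 1 < r), m ⟨i + 1, h⟩ ≤ l ⟨i, by omega⟩) ∧
             (∑ i, m i) = (∑ i, l i) + b),
        schurPoly m) = ∑ m ∈ S with ¬ ∃ i, Bad l m i, schurPoly m := by
    apply finsum_cond_eq_sum_of_cond_iff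
    intro m _
    rw [Finset.mem_filter, hS]
    simp only [Bad, not_exists, not_lt]
    tauto
  rw [hfin, Finset.sum_mul, Finset.sum_congr rfl (fun m _ => hs m), mul_right_comm, hs, alt_mul]
  have hB := bad_sum l hl (S.filter (fun m => ∃ i, Bad l m i)) ((∑ i, l i) + b) (by
    intro m
    rw [Finset.mem_filter, hS])
  have hsplit := Finset.sum_filter_add_sum_filter_not S (fun m => ∃ i, Bad l m i)
    (fun m => alt (fun i => m i + (r - 1 - (i : ℕ))))
  rw [hB, zero_add] at hsplit
  rw [hsplit, Finset.sum_map]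
  apply Finset.sum_congr rfl
  intro f _
  congr 1
  funext i
  simp only [Pi.add_apply, addLeftEmbedding_apply]
  ring
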